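/- There is an absolute constant C > 0 such that for every M ≥ 0, every θ ∈ {+1,−1}, and all nonzero ξ, η ∈ ℝ³, one has ‖Π_θ^M(ξ)·Π_{−θ}^M(η)‖ ≤ C(∠(ξ,η) + M(⟨ξ⟩_M⁻¹ + ⟨η⟩_M⁻¹)), where ‖·‖ is the operator norm on 4×4 complex matrices. -/

import Mathlib

noncomputable def pauli : Fin 3 → Matrix (Fin 2) (Fin 2) ℂ
  | 0 => !![0, 1; 1, 0]
  | 1 => !![0, -Complex.I; Complex.I, 0]
  | 2 => !![1, 0; 0, -1]

/-- The gamma matrices `γ⁰ = [[I₂,0],[0,−I₂]]`, `γʲ = [[0,σʲ],[−σʲ,0]]` in `2×2` blocks. -/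
noncomputable def gammaM : Fin 4 → Matrix (Fin 4) (Fin 4) ℂ
  | 0 => Matrix.reindex finSumFinEquiv finSumFinEquiv
      (Matrix.fromBlocks (1 : Matrix (Fin 2) (Fin 2) ℂ) 0 0 (-1 : Matrix (Fin 2) (Fin 2) ℂ))
  | 1 => Matrix.reindex finSumFinEquiv finSumFinEquiv
      (Matrix.fromBlocks 0 (pauli 0) (-(pauli 0)) 0)
  | 2 => Matrix.reindex finSumFinEquiv finSumFinEquiv
      (Matrix.fromBlocks 0 (pauli 1) (-(pauli 1)) 0)
  | 3 => Matrix.reindex finSumFinEquiv finSumFinEquiv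
      (Matrix.fromBlocks 0 (pauli 2) (-(pauli 2)) 0)

/-- `A(ξ) = Σ_{j=1}^{3} ξ_j γ⁰γʲ`. -/
noncomputable def diracA (ξ : EuclideanSpace ℝ (Fin 3)) : Matrix (Fin 4) (Fin 4) ℂ :=
  ∑ j : Fin 3, (ξ j : ℂ) • (gammaM 0 * gammaM j.succ)

/-- The (massless) Dirac projection symbol
`Π_θ(ξ) = (1/2)(I₄ + θ|ξ|⁻¹ Σ_j ξ_j γ⁰γʲ)`. -/
noncomputable def diracProj (θ : ℝ) (ξ : EuclideanSpace ℝ (Fin 3)) :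
    Matrix (Fin 4) (Fin 4) ℂ :=
  ((1 : ℂ) / 2) • ((1 : Matrix (Fin 4) (Fin 4) ℂ) + ((θ / ‖ξ‖ : ℝ) : ℂ) • diracA ξ)

/-- `⟨ξ⟩_M = (M² + |ξ|²)^{1/2}`. -/
noncomputable def jpM (M : ℝ) (ξ : EuclideanSpace ℝ (Fin 3)) : ℝ :=
  Real.sqrt (M ^ 2 + ‖ξ‖ ^ 2)

/-- The massive Dirac projection symbol
`Π_θ^M(ξ) = (1/2)(I₄ + θ⟨ξ⟩_M⁻¹(Σ_j ξ_j γ⁰γʲ + Mγ⁰))`. -/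
noncomputable def diracProjM (M θ : ℝ) (ξ : EuclideanSpace ℝ (Fin 3)) :
    Matrix (Fin 4) (Fin 4) ℂ :=
  ((1 : ℂ) / 2) • ((1 : Matrix (Fin 4) (Fin 4) ℂ)
    + ((θ / jpM M ξ : ℝ) : ℂ) • (diracA ξ + (M : ℂ) • gammaM 0))

/-- The operator norm of a `4×4` complex matrix, acting on `ℂ⁴` with the Euclidean norm. -/
noncomputable def opNorm (A : Matrix (Fin 4) (Fin 4) ℂ) : ℝ :=
  ‖Matrix.toEuclideanCLM (𝕜 := ℂ) (n := Fin 4) A‖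

open scoped Matrix.Norms.L2Operator

/-- The Dirac symbol `A(ζ) + mγ⁰`. -/
noncomputable def diracSymbol (ζ : EuclideanSpace ℝ (Fin 3)) (m : ℝ) :
    Matrix (Fin 4) (Fin 4) ℂ :=
  diracA ζ + (m : ℂ) • gammaM 0

theorem diracSymbol_sub (ζ ζ' : EuclideanSpace ℝ (Fin 3)) (m m' : ℝ) :
    diracSymbol ζ m - diracSymbol ζ' m' = diracSymbol (ζ - ζ') (m - m') := by
  simp only [diracSymbol, diracA, Fin.sum_univ_three, PiLp.sub_apply, Complex.ofReal_sub]
  module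

theorem diracSymbol_smul (c : ℝ) (ζ : EuclideanSpace ℝ (Fin 3)) (m : ℝ) :
    diracSymbol (c • ζ) (c * m) = (c : ℂ) • diracSymbol ζ m := by
  simp only [diracSymbol, diracA, Fin.sum_univ_three, PiLp.smul_apply, smul_eq_mul,
    Complex.ofReal_mul]
  module

theorem diracSymbol_eq (ζ : EuclideanSpace ℝ (Fin 3)) (m : ℝ) :
    diracSymbol ζ m =
      !![(m : ℂ), 0, (ζ 2 : ℂ), ζ 0 - Complex.I * ζ 1;
         0, (m : ℂ), ζ 0 + Complex.I * ζ 1, -(ζ 2 : ℂ);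
         (ζ 2 : ℂ), ζ 0 - Complex.I * ζ 1, -(m : ℂ), 0;
         ζ 0 + Complex.I * ζ 1, -(ζ 2 : ℂ), 0, -(m : ℂ)] := by
  have hl : ∀ i : Fin 2, finSumFinEquiv.symm (Fin.castAdd 2 i) = Sum.inl i :=
    finSumFinEquiv_symm_apply_castAdd
  have hr : ∀ i : Fin 2, finSumFinEquiv.symm (Fin.natAdd 2 i) = Sum.inr i :=
    finSumFinEquiv_symm_apply_natAdd
  have h0 : (finSumFinEquiv (m := 2) (n := 2)).symm 0 = Sum.inl 0 := hl 0
  have h1 : (finSumFinEquiv (m := 2) (n := 2)).symm 1 = Sum.inl 1 := hl 1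
  have h2 : (finSumFinEquiv (m := 2) (n := 2)).symm 2 = Sum.inr 0 := hr 0
  have h3 : (finSumFinEquiv (m := 2) (n := 2)).symm 3 = Sum.inr 1 := hr 1
  have e1 : (Fin.succ 0 : Fin 4) = 1 := rfl
  have e2 : (Fin.succ 1 : Fin 4) = 2 := rfl
  have e3 : (Fin.succ 2 : Fin 4) = 3 := rfl
  ext i j
  fin_cases i <;> fin_cases j <;>
    simp [diracSymbol, diracA, Fin.sum_univ_three, e1, e2, e3, gammaM, pauli, Matrix.mul_apply,
      h0, h1, h2, h3] <;> ring

theorem diracSymbol_mul_self (ζ : EuclideanSpace ℝ (Fin 3)) (m : ℝ) :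
    diracSymbol ζ m * diracSymbol ζ m = ((m ^ 2 + ‖ζ‖ ^ 2 : ℝ) : ℂ) • 1 := by
  have hn : ‖ζ‖ ^ 2 = ζ 0 ^ 2 + ζ 1 ^ 2 + ζ 2 ^ 2 := by
    simp [EuclideanSpace.norm_sq_eq, Fin.sum_univ_three]
  rw [hn, diracSymbol_eq]
  ext i j
  fin_cases i <;> fin_cases j <;>
    simp [Matrix.mul_apply, Fin.sum_univ_four] <;> ring_nf <;> simp

theorem exists_norm_diracSymbol_le :
    ∃ K : ℝ, 0 < K ∧ ∀ (ζ : EuclideanSpace ℝ (Fin 3)) (m : ℝ),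
      ‖diracSymbol ζ m‖ ≤ K * (‖ζ‖ + |m|) := by
  refine ⟨∑ j : Fin 3, ‖gammaM 0 * gammaM j.succ‖ + ‖gammaM 0‖ + 1, by positivity,
    fun ζ m ↦ ?_⟩
  have hA : ‖diracA ζ‖ ≤ (∑ j : Fin 3, ‖gammaM 0 * gammaM j.succ‖) * ‖ζ‖ := by
    rw [diracA, Finset.sum_mul]
    refine norm_sum_le_of_le _ fun j _ ↦ ?_
    rw [norm_smul, Complex.norm_real, mul_comm]
    gcongr
    exact PiLp.norm_apply_le ζ j
  have hm : ‖(m : ℂ) • gammaM 0‖ = ‖gammaM 0‖ * |m| := by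
    rw [norm_smul, Complex.norm_real, Real.norm_eq_abs, mul_comm]
  have hs : 0 ≤ ∑ j : Fin 3, ‖gammaM 0 * gammaM j.succ‖ :=
    Finset.sum_nonneg fun _ _ ↦ norm_nonneg _
  have hg := norm_nonneg (gammaM 0)
  refine (norm_add_le _ _).trans ((add_le_add hA hm.le).trans ?_)
  generalize ∑ j : Fin 3, ‖gammaM 0 * gammaM j.succ‖ = s at hs ⊢
  generalize ‖gammaM 0‖ = g at hg ⊢
  rw [mul_add]
  gcongr <;> linarith

theorem norm_sub_le_angle_of_norm_eq_one {V : Type*} [NormedAddCommGroup V]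
    [InnerProductSpace ℝ V] {u v : V} (hu : ‖u‖ = 1) (hv : ‖v‖ = 1) :
    ‖u - v‖ ≤ InnerProductGeometry.angle u v := by
  refine le_of_sq_le_sq ?_ (InnerProductGeometry.angle_nonneg u v)
  have hcos := InnerProductGeometry.cos_angle u v
  rw [hu, hv] at hcos
  have := Real.one_sub_sq_div_two_le_cos (x := InnerProductGeometry.angle u v)
  rw [@norm_sub_sq ℝ, hu, hv]
  simp at hcos ⊢
  linarith

theorem norm_inv_smul_sub_inv_norm_smul {V : Type*} [NormedAddCommGroup V]
    [NormedSpace ℝ V] {x : V} (hx : x ≠ 0) {a : ℝ} (ha : ‖x‖ ≤ a) :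
    ‖a⁻¹ • x - ‖x‖⁻¹ • x‖ = 1 - ‖x‖ / a := by
  have hx' : 0 < ‖x‖ := norm_pos_iff.2 hx
  have ha' : 0 < a := hx'.trans_le ha
  rw [← sub_smul, norm_smul, Real.norm_eq_abs,
    abs_of_nonpos (sub_nonpos.2 (inv_anti₀ hx' ha))]
  field_simp
  ring

theorem norm_inv_smul_sub_inv_smul_le {V : Type*} [NormedAddCommGroup V]
    [InnerProductSpace ℝ V] {x y : V} (hx : x ≠ 0) (hy : y ≠ 0) {a b : ℝ} (ha : ‖x‖ ≤ a)
    (hb : ‖y‖ ≤ b) :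
    ‖a⁻¹ • x - b⁻¹ • y‖ ≤ InnerProductGeometry.angle x y + (1 - ‖x‖ / a) + (1 - ‖y‖ / b) := by
  have hx' : 0 < ‖x‖⁻¹ := inv_pos.2 (norm_pos_iff.2 hx)
  have hy' : 0 < ‖y‖⁻¹ := inv_pos.2 (norm_pos_iff.2 hy)
  have huv := norm_sub_le_angle_of_norm_eq_one (norm_smul_inv_norm (𝕜 := ℝ) hx)
    (norm_smul_inv_norm (𝕜 := ℝ) hy)
  simp only [RCLike.ofReal_real_eq_id, id] at huv
  rw [InnerProductGeometry.angle_smul_left_of_pos _ _ hx',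
    InnerProductGeometry.angle_smul_right_of_pos _ _ hy'] at huv
  rw [← norm_inv_smul_sub_inv_norm_smul hx ha, ← norm_inv_smul_sub_inv_norm_smul hy hb]
  calc ‖a⁻¹ • x - b⁻¹ • y‖
      = ‖(‖x‖⁻¹ • x - ‖y‖⁻¹ • y) + (a⁻¹ • x - ‖x‖⁻¹ • x) - (b⁻¹ • y - ‖y‖⁻¹ • y)‖ := by
        congr 1; abel
    _ ≤ ‖‖x‖⁻¹ • x - ‖y‖⁻¹ • y‖ + ‖a⁻¹ • x - ‖x‖⁻¹ • x‖ + ‖b⁻¹ • y - ‖y‖⁻¹ • y‖ :=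
        (norm_sub_le _ _).trans (by gcongr; exact norm_add_le _ _)
    _ ≤ _ := by gcongr

section jpM

variable {M : ℝ} {ξ : EuclideanSpace ℝ (Fin 3)}

theorem jpM_sq : jpM M ξ ^ 2 = M ^ 2 + ‖ξ‖ ^ 2 := Real.sq_sqrt (by positivity)

theorem norm_le_jpM : ‖ξ‖ ≤ jpM M ξ := Real.le_sqrt_of_sq_le (by nlinarith)

theorem le_jpM : M ≤ jpM M ξ := Real.le_sqrt_of_sq_le (by nlinarith [sq_nonneg ‖ξ‖])

theorem jpM_le_add (hM : 0 ≤ M) : jpM M ξ ≤ M + ‖ξ‖ :=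
  Real.sqrt_le_iff.2 ⟨by positivity, by nlinarith [mul_nonneg hM (norm_nonneg ξ)]⟩

theorem jpM_pos (hξ : ξ ≠ 0) : 0 < jpM M ξ := (norm_pos_iff.2 hξ).trans_le norm_le_jpM

theorem one_sub_norm_div_jpM_le (hM : 0 ≤ M) (hξ : ξ ≠ 0) :
    1 - ‖ξ‖ / jpM M ξ ≤ M * (jpM M ξ)⁻¹ := by
  have h := jpM_pos (M := M) hξ
  rw [← div_eq_mul_inv, sub_le_iff_le_add, ← add_div, le_div_iff₀ h, one_mul]
  exact jpM_le_add hM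

end jpM

/-- The Dirac symbol normalised to be an involution. -/
noncomputable def diracSign (M : ℝ) (ξ : EuclideanSpace ℝ (Fin 3)) :
    Matrix (Fin 4) (Fin 4) ℂ :=
  diracSymbol ((jpM M ξ)⁻¹ • ξ) ((jpM M ξ)⁻¹ * M)

theorem diracProjM_eq (M θ : ℝ) (ξ : EuclideanSpace ℝ (Fin 3)) :
    diracProjM M θ ξ = ((1 : ℂ) / 2) • (1 + (θ : ℂ) • diracSign M ξ) := by
  rw [diracSign, diracSymbol_smul, diracProjM, diracSymbol, div_eq_mul_inv θ, Complex.ofReal_mul,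
    mul_smul (θ : ℂ)]

theorem diracSign_mul_self {M : ℝ} {ξ : EuclideanSpace ℝ (Fin 3)} (hξ : ξ ≠ 0) :
    diracSign M ξ * diracSign M ξ = 1 := by
  have h := jpM_pos (M := M) hξ
  rw [diracSign, diracSymbol_mul_self, norm_smul, mul_pow, mul_pow, Real.norm_eq_abs, sq_abs,
    ← mul_add, ← jpM_sq, inv_pow, inv_mul_cancel₀ (by positivity), Complex.ofReal_one, one_smul]

theorem diracProjM_mul_diracProjM_neg {M θ : ℝ} (hθ : θ = 1 ∨ θ = -1)
    {ξ : EuclideanSpace ℝ (Fin 3)} (hξ : ξ ≠ 0) (η : EuclideanSpace ℝ (Fin 3)) :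
    diracProjM M θ ξ * diracProjM M (-θ) η =
      ((1 : ℂ) / 4) • ((diracSign M ξ + (θ : ℂ) • 1) * (diracSign M ξ - diracSign M η)) := by
  have h := diracSign_mul_self (M := M) hξ
  have hθ2 : (θ : ℂ) * θ = 1 := by rcases hθ with rfl | rfl <;> simp
  rw [diracProjM_eq, diracProjM_eq, smul_mul_smul_comm]
  simp only [add_mul, mul_add, mul_sub, smul_mul_assoc, mul_smul_comm, one_mul, mul_one, h,
    Complex.ofReal_neg, neg_smul, mul_neg]
  linear_combination (norm := module) (-1 / 4 : ℂ) • hθ2 • (diracSign M ξ * diracSign M η)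

/-- `‖Π_θ^M(ξ) Π_{−θ}^M(η)‖ ≤ C(∠(ξ,η) + M(⟨ξ⟩_M⁻¹ + ⟨η⟩_M⁻¹))`. -/
theorem diracProjM_nullform_bound :
    ∃ C : ℝ, 0 < C ∧ ∀ M : ℝ, 0 ≤ M → ∀ θ : ℝ, (θ = 1 ∨ θ = -1) →
      ∀ ξ η : EuclideanSpace ℝ (Fin 3), ξ ≠ 0 → η ≠ 0 →
        opNorm (diracProjM M θ ξ * diracProjM M (-θ) η)
          ≤ C * (InnerProductGeometry.angle ξ η
              + M * ((jpM M ξ)⁻¹ + (jpM M η)⁻¹)) := by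
  obtain ⟨K, hK, hL⟩ := exists_norm_diracSymbol_le
  refine ⟨K * (2 * K + 1), by positivity, fun M hM θ hθ ξ η hξ hη ↦ ?_⟩
  have ha := jpM_pos (M := M) hξ
  have hb := jpM_pos (M := M) hη
  set a := jpM M ξ
  set b := jpM M η
  have hsign : ‖diracSign M ξ + (θ : ℂ) • 1‖ ≤ 2 * K + 1 := by
    have h1 : ‖a⁻¹ • ξ‖ ≤ 1 := by
      rw [norm_smul, norm_inv, Real.norm_of_nonneg ha.le]
      exact inv_mul_le_one_of_le₀ norm_le_jpM ha.le
    have h2 : |a⁻¹ * M| ≤ 1 := by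
      rw [abs_of_nonneg (by positivity)]
      exact inv_mul_le_one_of_le₀ le_jpM ha.le
    have h3 : ‖(θ : ℂ) • (1 : Matrix (Fin 4) (Fin 4) ℂ)‖ = 1 := by
      rcases hθ with rfl | rfl <;> simp
    have h4 : ‖diracSign M ξ‖ ≤ K * 2 := (hL _ _).trans (by gcongr; linarith)
    linarith [norm_add_le (diracSign M ξ) ((θ : ℂ) • 1)]
  have hdiff : ‖diracSign M ξ - diracSign M η‖ ≤
      K * (2 * (InnerProductGeometry.angle ξ η + M * (a⁻¹ + b⁻¹))) := by
    rw [diracSign, diracSign, diracSymbol_sub]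
    refine (hL _ _).trans ?_
    gcongr
    have h1 := norm_inv_smul_sub_inv_smul_le hξ hη (norm_le_jpM (M := M)) (norm_le_jpM (M := M))
    have h2 := one_sub_norm_div_jpM_le hM hξ
    have h3 := one_sub_norm_div_jpM_le hM hη
    have h4 : |a⁻¹ * M - b⁻¹ * M| ≤ a⁻¹ * M + b⁻¹ * M := by
      rw [abs_le]
      constructor <;> nlinarith [mul_nonneg (inv_pos.2 ha).le hM, mul_nonneg (inv_pos.2 hb).le hM]
    linarith [InnerProductGeometry.angle_nonneg ξ η]
  have hangle := InnerProductGeometry.angle_nonneg ξ η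
  change ‖diracProjM M θ ξ * diracProjM M (-θ) η‖ ≤ _
  calc ‖diracProjM M θ ξ * diracProjM M (-θ) η‖
      ≤ 1 / 4 * (‖diracSign M ξ + (θ : ℂ) • 1‖ * ‖diracSign M ξ - diracSign M η‖) := by
        rw [diracProjM_mul_diracProjM_neg hθ hξ, norm_smul]
        norm_num
        exact norm_mul_le _ _
    _ ≤ 1 / 4 * ((2 * K + 1) *
          (K * (2 * (InnerProductGeometry.angle ξ η + M * (a⁻¹ + b⁻¹))))) := by gcongr
    _ ≤ K * (2 * K + 1) * (InnerProductGeometry.angle ξ η + M * (a⁻¹ + b⁻¹)) := by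
        have : 0 ≤ K * (2 * K + 1) * (InnerProductGeometry.angle ξ η + M * (a⁻¹ + b⁻¹)) := by
          positivity
        linarith
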